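/- Suppose Assumption A1 holds (for f(y,d) = y − d). Define, for x ∈ X: S̲(x) = s*(x); s̲(x) = the smallest integer t with L(x,t) ≤ K + L(x, S̲(x)); s̄(x) = the smallest integer t with L(x,t) ≤ (1−β)K + L(x, S̲(x)); S̄(x) = the smallest integer t ≥ S̲(x) with βK + L(x, S̲(x)) ≤ L(x,t); S_n(x) = the smallest integer minimizing y ↦ G_n(x,y) over ℤ; and s_n(x) = the smallest integer t with G_n(x,t) ≤ K + G_n(x, S_n(x)). Then for every n ≥ 0 and every x ∈ X: s̲(x) ≤ s_n(x) ≤ s̄(x) ≤ S̲(x) ≤ S_n(x) ≤ S̄(x); moreover the (s_n(x), S_n(x)) policy is optimal for the (n+1)-period problem, i.e., v_{n+1}(x,s) = K + G_n(x, S_n(x)) for every integer s < s_n(x), and v_{n+1}(x,s) = G_n(x,s) for every integer s ≥ s_n(x). -/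

import Mathlib

open Finset

noncomputable section

open scoped Classical

namespace InvCtrl

variable {N M : ℕ} {Z : Type*}

/-- Membership in the belief space `X ⊆ ℝ^N`. -/
def memX (N : ℕ) (x : Fin N → ℝ) : Prop :=
  (∀ i, 0 ≤ x i) ∧ ∑ i, x i = 1

variable [Fintype Z]

/-- `σ(d_k, z, x) = x ⬝ P(d_k, z) ⬝ 𝟙`. -/
def sigz (P : Fin M → Z → Matrix (Fin N) (Fin N) ℝ) (k : Fin M) (z : Z) (x : Fin N → ℝ) : ℝ :=
  ∑ i, x i * ∑ j, P k z i j

/-- `σ(d_k, x) = ∑_z σ(d_k, z, x)`. -/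
def sig (P : Fin M → Z → Matrix (Fin N) (Fin N) ℝ) (k : Fin M) (x : Fin N → ℝ) : ℝ :=
  ∑ z, sigz P k z x

/-- Posterior belief `λ(d_k, z, x) = x P(d_k, z) / σ(d_k, z, x)` (componentwise). -/
def lam (P : Fin M → Z → Matrix (Fin N) (Fin N) ℝ) (k : Fin M) (z : Z) (x : Fin N → ℝ) :
    Fin N → ℝ :=
  fun j => (∑ i, x i * P k z i j) / sigz P k z x

/-- Single-period cost `c(y, d) = p·(d − y)⁺ + h·(y − d)⁺`. -/
def cst (p hc y dd : ℝ) : ℝ := p * max (dd - y) 0 + hc * max (y - dd) 0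

/-- Expected single-period cost `L(x, y) = ∑_k σ(d_k, x) c(y, d_k)`. -/
def Lf (P : Fin M → Z → Matrix (Fin N) (Fin N) ℝ) (d : Fin M → ℤ) (p hc : ℝ)
    (x : Fin N → ℝ) (y : ℝ) : ℝ :=
  ∑ k, sig P k x * cst p hc y (d k : ℝ)

/-- `s*(x)`: the smallest element of `{d_1, …, d_M}` at which `m ↦ L(x, d_m)` is minimized. -/
def sStar (P : Fin M → Z → Matrix (Fin N) (Fin N) ℝ) (d : Fin M → ℤ) (p hc : ℝ)
    (x : Fin N → ℝ) : ℤ :=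
  sInf {t : ℤ | ∃ m : Fin M, t = d m ∧ ∀ k : Fin M, Lf P d p hc x (d m : ℝ) ≤ Lf P d p hc x (d k : ℝ)}

/-- First-order stochastic dominance `x ⪯ x'`. -/
def sdom (x x' : Fin N → ℝ) : Prop :=
  ∀ n : Fin N, ∑ i ∈ univ.filter (fun i => n ≤ i), x i ≤ ∑ i ∈ univ.filter (fun i => n ≤ i), x' i

/-- The `i`-th standard unit vector in `ℝ^N`. -/
def eV (N : ℕ) (i : Fin N) : Fin N → ℝ := fun j => if j = i then 1 else 0

/-- Assumption A3. -/
def A3 (P : Fin M → Z → Matrix (Fin N) (Fin N) ℝ) : Prop :=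
  ∀ i i' : Fin N, i ≤ i' → ∀ m : Fin M,
    ∑ k ∈ univ.filter (fun k : Fin M => m ≤ k), ∑ j, ∑ z, P k z i j ≤
      ∑ k ∈ univ.filter (fun k : Fin M => m ≤ k), ∑ j, ∑ z, P k z i' j

/-- `A_m(x) = h ∑_{k=1}^m σ(d_k,x) − p ∑_{k=m+1}^M σ(d_k,x)` (for `m = 0, …, M`). -/
def Am (P : Fin M → Z → Matrix (Fin N) (Fin N) ℝ) (p hc : ℝ) (m : ℕ) (x : Fin N → ℝ) : ℝ :=
  hc * ∑ k ∈ univ.filter (fun k : Fin M => (k : ℕ) < m), sig P k x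
    - p * ∑ k ∈ univ.filter (fun k : Fin M => m ≤ (k : ℕ)), sig P k x

/-- `B_m(x) = p ∑_{k=m+1}^M d_k σ(d_k,x) − h ∑_{k=1}^m d_k σ(d_k,x)` (for `m = 0, …, M`). -/
def Bm (P : Fin M → Z → Matrix (Fin N) (Fin N) ℝ) (d : Fin M → ℤ) (p hc : ℝ) (m : ℕ)
    (x : Fin N → ℝ) : ℝ :=
  p * ∑ k ∈ univ.filter (fun k : Fin M => m ≤ (k : ℕ)), (d k : ℝ) * sig P k x
    - hc * ∑ k ∈ univ.filter (fun k : Fin M => (k : ℕ) < m), (d k : ℝ) * sig P k x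

/-- Value iteration with reorder cost `K`: `v_0 = 0` and
`v_{n+1}(x,s) = inf_{y ≥ s, y ∈ ℤ} [ K ξ(y−s) + L(x,y) + β ∑_{(d_k,z) : σ ≠ 0}
σ(d_k,z,x) v_n(λ(d_k,z,x), y − d_k) ]`, `ξ(0) = 0`, `ξ(t) = 1` for `t ≠ 0`. -/
def vIterK (P : Fin M → Z → Matrix (Fin N) (Fin N) ℝ) (d : Fin M → ℤ) (p hc β K : ℝ) :
    ℕ → (Fin N → ℝ) → ℤ → ℝ
  | 0, _, _ => 0
  | n + 1, x, s =>
    sInf {r : ℝ | ∃ y : ℤ, s ≤ y ∧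
      r = K * (if y = s then 0 else 1) +
        (Lf P d p hc x (y : ℝ) + β * ∑ k, ∑ z,
          (if sigz P k z x = 0 then 0
           else sigz P k z x * vIterK P d p hc β K n (lam P k z x) (y - d k)))}

/-- `G_n(x,y) = L(x,y) + β ∑_{(d_k,z) : σ ≠ 0} σ(d_k,z,x) v_n(λ(d_k,z,x), y − d_k)`. -/
def GKfun (P : Fin M → Z → Matrix (Fin N) (Fin N) ℝ) (d : Fin M → ℤ) (p hc β K : ℝ)
    (n : ℕ) (x : Fin N → ℝ) (y : ℤ) : ℝ :=
  Lf P d p hc x (y : ℝ) + β * ∑ k, ∑ z,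
    (if sigz P k z x = 0 then 0
     else sigz P k z x * vIterK P d p hc β K n (lam P k z x) (y - d k))

/-- `S̲(x) = s*(x)` (smallest minimizer of `L(x,·)` on the grid). -/
def SLow (P : Fin M → Z → Matrix (Fin N) (Fin N) ℝ) (d : Fin M → ℤ) (p hc : ℝ)
    (x : Fin N → ℝ) : ℤ :=
  sStar P d p hc x

/-- `s̲(x)`: the smallest integer `t` with `L(x,t) ≤ K + L(x, S̲(x))`. -/
def sLow (P : Fin M → Z → Matrix (Fin N) (Fin N) ℝ) (d : Fin M → ℤ) (p hc K : ℝ)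
    (x : Fin N → ℝ) : ℤ :=
  sInf {t : ℤ | Lf P d p hc x (t : ℝ) ≤ K + Lf P d p hc x ((SLow P d p hc x : ℤ) : ℝ)}

/-- `s̄(x)`: the smallest integer `t` with `L(x,t) ≤ (1−β)K + L(x, S̲(x))`. -/
def sHigh (P : Fin M → Z → Matrix (Fin N) (Fin N) ℝ) (d : Fin M → ℤ) (p hc β K : ℝ)
    (x : Fin N → ℝ) : ℤ :=
  sInf {t : ℤ | Lf P d p hc x (t : ℝ) ≤ (1 - β) * K + Lf P d p hc x ((SLow P d p hc x : ℤ) : ℝ)}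

/-- `S̄(x)`: the smallest integer `t ≥ S̲(x)` with `βK + L(x, S̲(x)) ≤ L(x,t)`. -/
def SHigh (P : Fin M → Z → Matrix (Fin N) (Fin N) ℝ) (d : Fin M → ℤ) (p hc β K : ℝ)
    (x : Fin N → ℝ) : ℤ :=
  sInf {t : ℤ | SLow P d p hc x ≤ t ∧
    β * K + Lf P d p hc x ((SLow P d p hc x : ℤ) : ℝ) ≤ Lf P d p hc x (t : ℝ)}

/-- `S_n(x)`: the smallest integer minimizing `G_n(x,·)` over `ℤ`. -/
def Sn (P : Fin M → Z → Matrix (Fin N) (Fin N) ℝ) (d : Fin M → ℤ) (p hc β K : ℝ)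
    (n : ℕ) (x : Fin N → ℝ) : ℤ :=
  sInf {t : ℤ | ∀ y : ℤ, GKfun P d p hc β K n x t ≤ GKfun P d p hc β K n x y}

/-- `s_n(x)`: the smallest integer `t` with `G_n(x,t) ≤ K + G_n(x, S_n(x))`. -/
def sn (P : Fin M → Z → Matrix (Fin N) (Fin N) ℝ) (d : Fin M → ℤ) (p hc β K : ℝ)
    (n : ℕ) (x : Fin N → ℝ) : ℤ :=
  sInf {t : ℤ | GKfun P d p hc β K n x t ≤ K + GKfun P d p hc β K n x (Sn P d p hc β K n x)}


/-- Integer `K`-convexity, three-point form. -/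
def KCv (K : ℝ) (g : ℤ → ℝ) : Prop :=
  ∀ u b y : ℤ, u < b → b < y →
    g b * ((y : ℝ) - u) ≤ ((b : ℝ) - u) * (K + g y) + ((y : ℝ) - b) * g u

theorem int_sInf_mem {A : Set ℤ} (hne : A.Nonempty) (hb : BddBelow A) : sInf A ∈ A :=
  Int.csInf_mem hne hb

theorem exists_min_of_coercive {g : ℤ → ℝ} (hg : ∀ c, {t : ℤ | g t ≤ c}.Finite) :
    ∃ t, ∀ y, g t ≤ g y := by
  obtain ⟨t, ht, hmin⟩ := Set.exists_min_image {t : ℤ | g t ≤ g 0} g (hg _) ⟨0, le_refl (g 0)⟩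
  refine ⟨t, fun y => ?_⟩
  by_cases hy : g y ≤ g 0
  · exact hmin y hy
  · exact le_trans ht (le_of_lt (not_le.mp hy))

theorem core (L w : ℤ → ℝ) (a : ℤ) (K β : ℝ) (hK : 0 < K) (hβ0 : 0 ≤ β) (hβ1 : β < 1)
    (hLstrict : ∀ y, y < a → L a < L y) (hLmin : ∀ y, L a ≤ L y) (hL0 : ∀ y, 0 ≤ L y)
    (hLcv : KCv 0 L) (hLco : ∀ c, {t : ℤ | L t ≤ c}.Finite)
    (hw0 : ∀ y, 0 ≤ w y) (hwK : ∀ s y, s ≤ y → w s ≤ K + w y) (hwcv : KCv K w)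
    (hwa : ∀ s y, s ≤ y → y ≤ a → w y ≤ w s)
    (G v : ℤ → ℝ) (hG : ∀ y, G y = L y + β * w y)
    (hv : ∀ s, v s = sInf {r : ℝ | ∃ y : ℤ, s ≤ y ∧ r = K * (if y = s then 0 else 1) + G y})
    (S s' : ℤ) (hS : S = sInf {t : ℤ | ∀ y, G t ≤ G y}) (hs' : s' = sInf {t : ℤ | G t ≤ K + G S}) :
    ((sInf {t : ℤ | L t ≤ K + L a} ≤ s' ∧
      s' ≤ sInf {t : ℤ | L t ≤ (1 - β) * K + L a} ∧
      sInf {t : ℤ | L t ≤ (1 - β) * K + L a} ≤ a ∧ a ≤ S ∧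
      S ≤ sInf {t : ℤ | a ≤ t ∧ β * K + L a ≤ L t}) ∧
      (∀ s, s < s' → v s = K + G S) ∧ (∀ s, s' ≤ s → v s = G s)) ∧
    ((∀ y, 0 ≤ v y) ∧ (∀ s y, s ≤ y → v s ≤ K + v y) ∧ KCv K v ∧
      (∀ s y, s ≤ y → y ≤ a → v y ≤ v s)) := by
  have hLanti : ∀ s y, s ≤ y → y ≤ a → L y ≤ L s := by
    intro s y h1 h2
    rcases h1.eq_or_lt with rfl | h1
    · exact le_rfl
    rcases h2.eq_or_lt with rfl | h2
    · exact hLmin s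
    have h := hLcv s y a h1 h2
    have h1' : (s : ℝ) < y := by exact_mod_cast h1
    have h2' : (y : ℝ) < a := by exact_mod_cast h2
    have := hLmin s
    by_contra hh
    push Not at hh
    nlinarith [mul_pos (sub_pos.2 h2') (sub_pos.2 hh), mul_nonneg (sub_nonneg.2 h1'.le) (sub_nonneg.2 (hLmin y)), mul_pos (sub_pos.2 h1') (sub_pos.2 (lt_of_le_of_lt (hLmin s) hh))]
  have hLmono : ∀ s y, a ≤ s → s ≤ y → L s ≤ L y := by
    intro s y h2 h1
    rcases h1.eq_or_lt with rfl | h1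
    · exact le_rfl
    rcases h2.eq_or_lt with rfl | h2
    · exact hLmin y
    have h := hLcv a s y h2 h1
    have h1' : (s : ℝ) < y := by exact_mod_cast h1
    have h2' : (a : ℝ) < s := by exact_mod_cast h2
    by_contra hh
    push Not at hh
    nlinarith [mul_pos (sub_pos.2 h2') (sub_pos.2 hh), mul_nonneg (sub_nonneg.2 h1'.le) (sub_nonneg.2 (hLmin s))]
  have hGco : ∀ c, {t : ℤ | G t ≤ c}.Finite := by
    intro c
    refine (hLco c).subset fun t ht => ?_
    have : G t ≤ c := ht
    have h2 := mul_nonneg hβ0 (hw0 t)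
    rw [hG] at this
    show L t ≤ c
    linarith
  have hGcv : KCv K G := by
    intro u b y h1 h2
    have e1 := hLcv u b y h1 h2
    have e2 := mul_le_mul_of_nonneg_left (hwcv u b y h1 h2) hβ0
    have h1' : (u : ℝ) < b := by exact_mod_cast h1
    have e3 : 0 ≤ (1 - β) * (((b : ℝ) - u) * K) :=
      mul_nonneg (by linarith) (mul_nonneg (by linarith) hK.le)
    rw [hG, hG, hG]
    nlinarith
  have hGanti : ∀ s y, s ≤ y → y ≤ a → G y ≤ G s := by
    intro s y h1 h2
    rw [hG, hG]
    have := mul_le_mul_of_nonneg_left (hwa s y h1 h2) hβ0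
    linarith [hLanti s y h1 h2]
  -- S
  have hSbdd : BddBelow {t : ℤ | ∀ y, G t ≤ G y} := by
    refine ((hGco (G 0)).subset fun t ht => ?_).bddBelow
    exact ht 0
  have hSmem : ∀ y, G S ≤ G y := by
    rw [hS]; exact int_sInf_mem (exists_min_of_coercive hGco) hSbdd
  have hsbdd : BddBelow {t : ℤ | G t ≤ K + G S} := (hGco _).bddBelow
  have hsmem : G s' ≤ K + G S := by
    rw [hs']; exact int_sInf_mem (A := {t : ℤ | G t ≤ K + G S}) ⟨S, by
      show G S ≤ K + G S
      linarith⟩ hsbdd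
  have hsle : ∀ t, G t ≤ K + G S → s' ≤ t := fun t ht => by rw [hs']; exact csInf_le hsbdd ht
  have hslt : ∀ t, t < s' → K + G S < G t := by
    intro t ht
    by_contra hh
    exact absurd (hsle t (not_lt.mp hh)) (not_le.mpr ht)
  have hsS : s' ≤ S := hsle S (by linarith)
  have haS : a ≤ S := by
    by_contra hh
    push Not at hh
    have h1 := hSmem a
    have h2 := hLstrict S hh
    have h3 := mul_le_mul_of_nonneg_left (hwa S a hh.le le_rfl) hβ0
    rw [hG, hG] at h1
    linarith
  have hhmem : a ∈ {t : ℤ | L t ≤ (1 - β) * K + L a} := by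
    show L a ≤ (1 - β) * K + L a
    nlinarith
  have hhb : BddBelow {t : ℤ | L t ≤ (1 - β) * K + L a} := (hLco _).bddBelow
  have hha : sInf {t : ℤ | L t ≤ (1 - β) * K + L a} ≤ a := csInf_le hhb hhmem
  have hh' : L (sInf {t : ℤ | L t ≤ (1 - β) * K + L a}) ≤ (1 - β) * K + L a :=
    int_sInf_mem ⟨a, hhmem⟩ hhb
  have hsh : s' ≤ sInf {t : ℤ | L t ≤ (1 - β) * K + L a} := by
    apply hsle
    generalize sInf {t : ℤ | L t ≤ (1 - β) * K + L a} = q at *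
    rw [hG, hG]
    have h3 := mul_le_mul_of_nonneg_left (hwK q S (hha.trans haS)) hβ0
    linarith [hLmin S]
  have hlow : sInf {t : ℤ | L t ≤ K + L a} ≤ s' := by
    apply csInf_le (hLco _).bddBelow
    show L s' ≤ K + L a
    have h1 := hSmem a
    have h3 := mul_le_mul_of_nonneg_left (hwa s' a (hsh.trans hha) le_rfl) hβ0
    rw [hG a] at h1
    rw [hG s'] at hsmem
    linarith
  have hup : S ≤ sInf {t : ℤ | a ≤ t ∧ β * K + L a ≤ L t} := by
    have hne : {t : ℤ | a ≤ t ∧ β * K + L a ≤ L t}.Nonempty := by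
      by_contra hemp
      rw [Set.not_nonempty_iff_eq_empty] at hemp
      have : (Set.Ici a).Finite := by
        refine (hLco (β * K + L a)).subset fun t ht => ?_
        by_contra hh
        have : t ∈ {t : ℤ | a ≤ t ∧ β * K + L a ≤ L t} := ⟨ht, (not_le.mp hh).le⟩
        rw [hemp] at this
        exact this
      exact Set.Ici_infinite a this
    apply le_csInf hne
    rintro t ⟨h1, h2⟩
    by_contra hh
    push Not at hh
    have h3 := hLmono t S h1 hh.le
    have h4 := mul_le_mul_of_nonneg_left (hwK a S haS) hβ0
    have h5 : G a ≤ G S := by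
      rw [hG, hG]; linarith
    have h6 : S ≤ a := by
      rw [hS]
      exact csInf_le hSbdd fun y => h5.trans (hSmem y)
    omega
  -- policy
  have hpol : ∀ b y, s' ≤ b → b ≤ y → G b ≤ K + G y := by
    intro b y h1 h2
    rcases h2.eq_or_lt with rfl | h2
    · linarith
    rcases le_or_gt b S with hb | hb
    · have : G b ≤ K + G S := by
        rcases h1.eq_or_lt with rfl | h1
        · exact hsmem
        rcases hb.eq_or_lt with rfl | hb
        · linarith
        have h := hGcv s' b S h1 hb
        have h1' : (s' : ℝ) < b := by exact_mod_cast h1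
        have h2' : (b : ℝ) < S := by exact_mod_cast hb
        by_contra hh
        push Not at hh
        nlinarith [mul_pos (sub_pos.2 h1') (sub_pos.2 hh), mul_pos (sub_pos.2 h2') (sub_pos.2 (lt_of_le_of_lt hsmem hh))]
      linarith [hSmem y]
    · have h := hGcv S b y hb h2
      have h1' : (S : ℝ) < b := by exact_mod_cast hb
      have h2' : (b : ℝ) < y := by exact_mod_cast h2
      by_contra hh
      push Not at hh
      nlinarith [mul_pos (sub_pos.2 h1') (sub_pos.2 hh), mul_nonneg (sub_pos.2 h2').le (sub_nonneg.2 (hSmem b))]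
  have hv1 : ∀ s, s < s' → v s = K + G S := by
    intro s hs
    rw [hv]
    apply IsLeast.csInf_eq
    constructor
    · refine ⟨S, by omega, ?_⟩
      rw [if_neg (by omega)]; ring
    · rintro r ⟨y, hy, rfl⟩
      split_ifs with h
      · subst h; linarith [hslt y hs]
      · linarith [hSmem y]
  have hv2 : ∀ s, s' ≤ s → v s = G s := by
    intro s hs
    rw [hv]
    apply IsLeast.csInf_eq
    constructor
    · exact ⟨s, le_rfl, by simp⟩
    · rintro r ⟨y, hy, rfl⟩
      split_ifs with h
      · subst h; linarith
      · linarith [hpol s y hs hy]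
  have hG0 : ∀ y, 0 ≤ G y := fun y => by
    rw [hG]; linarith [hL0 y, mul_nonneg hβ0 (hw0 y)]
  have hvS : ∀ y, G S ≤ v y := by
    intro y
    rcases lt_or_ge y s' with h | h
    · rw [hv1 y h]; linarith
    · rw [hv2 y h]; exact hSmem y
  refine ⟨⟨⟨hlow, hsh, hha, haS, hup⟩, hv1, hv2⟩, ?_, ?_, ?_, ?_⟩
  · exact fun y => (hG0 S).trans (hvS y)
  · intro s y h
    rcases lt_or_ge s s' with h1 | h1
    · rw [hv1 s h1]; linarith [hvS y]
    · rw [hv2 s h1, hv2 y (h1.trans h)]; exact hpol s y h1 h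
  · intro u b y h1 h2
    have h1' : (u : ℝ) < b := by exact_mod_cast h1
    have h2' : (b : ℝ) < y := by exact_mod_cast h2
    rcases le_or_gt s' u with hu | hu
    · rw [hv2 u hu, hv2 b (by omega), hv2 y (by omega)]
      exact hGcv u b y h1 h2
    · rcases lt_or_ge b s' with hb | hb
      · rw [hv1 u hu, hv1 b hb]
        nlinarith [mul_nonneg (sub_pos.2 h1').le (sub_nonneg.2 (hvS y))]
      · rw [hv1 u hu, hv2 b hb, hv2 y (by omega)]
        have hby := hpol b y hb h2.le
        have m1 := mul_nonneg (sub_pos.2 h1').le (sub_nonneg.2 hby)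
        by_cases hbS : G b ≤ K + G S
        · nlinarith [mul_nonneg (sub_pos.2 h2').le (sub_nonneg.2 hbS)]
        · have hSb : S < b := by
            by_contra hh
            exact hbS (hpol b S hb (not_lt.mp hh))
          have h := hGcv S b y hSb h2
          have h3 : (u : ℝ) ≤ S := by exact_mod_cast (hu.le.trans hsS)
          nlinarith [mul_nonneg (sub_nonneg.2 h3) (sub_nonneg.2 hby), mul_nonneg (sub_pos.2 h2').le hK.le]
  · intro s y h h2
    rcases lt_or_ge y s' with h1 | h1
    · rw [hv1 y h1, hv1 s (by omega)]
    · rw [hv2 y h1]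
      rcases lt_or_ge s s' with h3 | h3
      · rw [hv1 s h3]; exact hpol y S h1 (h2.trans haS)
      · rw [hv2 s h3]; exact hGanti s y h h2

theorem cst_cv (p hc : ℝ) (hp : 0 < p) (hhc : 0 < hc) (e u b y : ℝ) (h1 : u < b) (h2 : b < y) :
    cst p hc b e * (y - u) ≤ (b - u) * cst p hc y e + (y - b) * cst p hc u e := by
  unfold cst
  have hb : b * (y - u) = (b - u) * y + (y - b) * u := by ring
  have hA : max (e - b) 0 * (y - u) ≤ (b - u) * max (e - y) 0 + (y - b) * max (e - u) 0 := by
    rcases max_cases (e - b) 0 with ⟨h, _⟩ | ⟨h, _⟩ <;> rw [h]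
    · nlinarith [mul_le_mul_of_nonneg_left (le_max_left (e - y) 0) (sub_pos.2 h1).le,
        mul_le_mul_of_nonneg_left (le_max_left (e - u) 0) (sub_pos.2 h2).le]
    · nlinarith [mul_le_mul_of_nonneg_left (le_max_right (e - y) 0) (sub_pos.2 h1).le,
        mul_le_mul_of_nonneg_left (le_max_right (e - u) 0) (sub_pos.2 h2).le]
  have hB : max (b - e) 0 * (y - u) ≤ (b - u) * max (y - e) 0 + (y - b) * max (u - e) 0 := by
    rcases max_cases (b - e) 0 with ⟨h, _⟩ | ⟨h, _⟩ <;> rw [h]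
    · nlinarith [mul_le_mul_of_nonneg_left (le_max_left (y - e) 0) (sub_pos.2 h1).le,
        mul_le_mul_of_nonneg_left (le_max_left (u - e) 0) (sub_pos.2 h2).le]
    · nlinarith [mul_le_mul_of_nonneg_left (le_max_right (y - e) 0) (sub_pos.2 h1).le,
        mul_le_mul_of_nonneg_left (le_max_right (u - e) 0) (sub_pos.2 h2).le]
  nlinarith [mul_le_mul_of_nonneg_left hA hp.le, mul_le_mul_of_nonneg_left hB hhc.le]

theorem cst_low (p hc e y : ℝ) (h : e ≤ y) : cst p hc y e = hc * (y - e) := by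
  unfold cst
  rw [max_eq_right (by linarith), max_eq_left (by linarith)]; ring

theorem cst_high (p hc e y : ℝ) (h : y ≤ e) : cst p hc y e = p * (e - y) := by
  unfold cst
  rw [max_eq_left (by linarith), max_eq_right (by linarith)]; ring

/-- Abstract facts on a weighted newsvendor cost. -/
theorem newsvendor {M : ℕ} (hM : 1 ≤ M) (d : Fin M → ℤ) (p hc : ℝ) (hp : 0 < p) (hhc : 0 < hc)
    (q : Fin M → ℝ) (hq : ∀ k, 0 ≤ q k) (hq1 : ∑ k, q k = 1)
    (F : ℝ → ℝ) (hF : ∀ y, F y = ∑ k, q k * cst p hc y (d k : ℝ)) (a : ℤ)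
    (ha : a = sInf {t : ℤ | ∃ m : Fin M, t = d m ∧ ∀ k : Fin M, F (d m : ℝ) ≤ F (d k : ℝ)}) :
    (∀ y : ℤ, y < a → F a < F y) ∧ (∀ y : ℤ, F a ≤ F y) ∧ (∀ y : ℤ, 0 ≤ F y) ∧
      KCv 0 (fun y : ℤ => F y) ∧ (∀ c, {t : ℤ | F t ≤ c}.Finite) := by
  have hF0 : ∀ y, 0 ≤ F y := fun y => by
    rw [hF]
    refine Finset.sum_nonneg fun k _ => mul_nonneg (hq k) ?_
    unfold cst; positivity
  have : Nonempty (Fin M) := ⟨⟨0, hM⟩⟩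
  have hAne : {t : ℤ | ∃ m : Fin M, t = d m ∧ ∀ k : Fin M, F (d m : ℝ) ≤ F (d k : ℝ)}.Nonempty := by
    obtain ⟨m, hm⟩ := Finite.exists_min (fun k : Fin M => F (d k : ℝ))
    exact ⟨d m, m, rfl, hm⟩
  have hAb : BddBelow {t : ℤ | ∃ m : Fin M, t = d m ∧ ∀ k : Fin M, F (d m : ℝ) ≤ F (d k : ℝ)} := by
    refine ((Set.finite_range d).subset ?_).bddBelow
    rintro t ⟨m, rfl, _⟩
    exact ⟨m, rfl⟩
  have hmem := int_sInf_mem hAne hAb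
  rw [← ha] at hmem
  obtain ⟨m0, hm0, hmin⟩ := hmem
  rw [← hm0] at hmin
  -- claim
  have claim : ∀ y : ℤ, ∃ m, F (d m) < F y ∨ (d m ≤ y ∧ F (d m) ≤ F y) := by
    intro y
    by_cases hlo : ∃ k, d k ≤ y
    · obtain ⟨i, hi, himax⟩ := Finset.exists_max_image (univ.filter fun k => d k ≤ y) d
        (by obtain ⟨k, hk⟩ := hlo; exact ⟨k, by simpa using hk⟩)
      simp only [Finset.mem_filter, Finset.mem_univ, true_and] at hi himax
      have hiR : (d i : ℝ) ≤ y := by exact_mod_cast hi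
      by_cases hhi : ∃ k, y < d k
      · obtain ⟨j, hj, hjmin⟩ := Finset.exists_min_image (univ.filter fun k => y < d k) d
          (by obtain ⟨k, hk⟩ := hhi; exact ⟨k, by simpa using hk⟩)
        simp only [Finset.mem_filter, Finset.mem_univ, true_and] at hj hjmin
        have hjR : (y : ℝ) < d j := by exact_mod_cast hj
        have key : ((d j : ℝ) - d i) * F y = (d j - y) * F (d i) + (y - d i) * F (d j) := by
          rw [hF, hF, hF, Finset.mul_sum, Finset.mul_sum, Finset.mul_sum, ← Finset.sum_add_distrib]
          refine Finset.sum_congr rfl fun k _ => ?_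
          rcases le_or_gt (d k) y with hk | hk
          · have h1 : (d k : ℝ) ≤ d i := by exact_mod_cast himax k hk
            rw [cst_low _ _ _ _ h1, cst_low _ _ _ _ (h1.trans hiR), cst_low _ _ _ _ (by linarith)]
            ring
          · have h1 : (d j : ℝ) ≤ d k := by exact_mod_cast hjmin k hk
            rw [cst_high _ _ _ _ h1, cst_high _ _ _ (y : ℝ) (by linarith), cst_high _ _ _ _ (by linarith)]
            ring
        by_cases hc1 : F (d i) ≤ F y
        · exact ⟨i, Or.inr ⟨hi, hc1⟩⟩
        · refine ⟨j, Or.inl ?_⟩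
          push Not at hc1
          by_contra hc2
          push Not at hc2
          nlinarith [mul_pos (sub_pos.2 hjR) (sub_pos.2 hc1), mul_nonneg (sub_nonneg.2 hiR) (sub_nonneg.2 hc2)]
      · push Not at hhi
        refine ⟨i, Or.inr ⟨hi, ?_⟩⟩
        rw [hF, hF]
        refine Finset.sum_le_sum fun k _ => mul_le_mul_of_nonneg_left ?_ (hq k)
        have h1 : (d k : ℝ) ≤ d i := by exact_mod_cast himax k (hhi k)
        rw [cst_low _ _ _ _ h1, cst_low _ _ _ _ (h1.trans hiR)]
        nlinarith
    · push Not at hlo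
      obtain ⟨i, hi⟩ := Finite.exists_min d
      refine ⟨i, Or.inl ?_⟩
      have hiR : (y : ℝ) < d i := by exact_mod_cast hlo i
      have : F y = F (d i) + p * (d i - y) * ∑ k, q k := by
        rw [hF, hF, Finset.mul_sum, ← Finset.sum_add_distrib]
        refine Finset.sum_congr rfl fun k _ => ?_
        have h1 : (d i : ℝ) ≤ d k := by exact_mod_cast hi k
        rw [cst_high _ _ _ _ h1, cst_high _ _ _ (y : ℝ) (by linarith)]
        ring
      rw [this, hq1]
      nlinarith [mul_pos hp (sub_pos.2 hiR)]
  refine ⟨?_, ?_, fun y => hF0 y, ?_, ?_⟩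
  · intro y hy
    obtain ⟨m, hm | ⟨hm1, hm2⟩⟩ := claim y
    · exact (hmin m).trans_lt hm
    · refine lt_of_lt_of_le ?_ hm2
      by_contra hh
      push Not at hh
      have : a ≤ d m := by
        rw [ha]
        exact csInf_le hAb ⟨m, rfl, fun k => hh.trans (hmin k)⟩
      omega
  · intro y
    obtain ⟨m, hm | ⟨hm1, hm2⟩⟩ := claim y
    · exact (hmin m).trans hm.le
    · exact (hmin m).trans hm2
  · intro u b y h1 h2
    have h1' : (u : ℝ) < b := by exact_mod_cast h1
    have h2' : (b : ℝ) < y := by exact_mod_cast h2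
    show F b * _ ≤ _ * (0 + F y) + _ * F u
    rw [zero_add, hF, hF, hF, Finset.sum_mul, Finset.mul_sum, Finset.mul_sum, ← Finset.sum_add_distrib]
    refine Finset.sum_le_sum fun k _ => ?_
    have := mul_le_mul_of_nonneg_left (cst_cv p hc hp hhc (d k) u b y h1' h2') (hq k)
    linarith
  · intro c
    set E := ∑ k, q k * (d k : ℝ) with hE
    have hlow : ∀ y : ℝ, p * (E - y) ≤ F y := by
      intro y
      have : p * (E - y) = p * (∑ k, q k * (d k : ℝ) - y * ∑ k, q k) := by rw [hq1, hE]; ring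
      rw [this, Finset.mul_sum, ← Finset.sum_sub_distrib, Finset.mul_sum, hF]
      refine Finset.sum_le_sum fun k _ => ?_
      have : p * ((d k : ℝ) - y) ≤ cst p hc y (d k) := by
        unfold cst
        nlinarith [mul_le_mul_of_nonneg_left (le_max_left ((d k : ℝ) - y) 0) hp.le, mul_nonneg hhc.le (le_max_right (y - (d k : ℝ)) 0)]
      nlinarith [mul_le_mul_of_nonneg_left this (hq k)]
    have hhigh : ∀ y : ℝ, hc * (y - E) ≤ F y := by
      intro y
      have : hc * (y - E) = hc * (y * ∑ k, q k - ∑ k, q k * (d k : ℝ)) := by rw [hq1, hE]; ring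
      rw [this, Finset.mul_sum, ← Finset.sum_sub_distrib, Finset.mul_sum, hF]
      refine Finset.sum_le_sum fun k _ => ?_
      have : hc * (y - (d k : ℝ)) ≤ cst p hc y (d k) := by
        unfold cst
        nlinarith [mul_le_mul_of_nonneg_left (le_max_left (y - (d k : ℝ)) 0) hhc.le, mul_nonneg hp.le (le_max_right ((d k : ℝ) - y) 0)]
      nlinarith [mul_le_mul_of_nonneg_left this (hq k)]
    refine (Set.finite_Icc ⌊E - c / p⌋ ⌈E + c / hc⌉).subset fun t ht => ?_
    have ht' : F t ≤ c := ht
    constructor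
    · have h := (hlow t).trans ht'
      have : E - t ≤ c / p := by rw [le_div_iff₀ hp]; linarith
      have h3 : (⌊E - c / p⌋ : ℝ) ≤ t := (Int.floor_le _).trans (by linarith)
      exact_mod_cast h3
    · have h := (hhigh t).trans ht'
      have : t - E ≤ c / hc := by rw [le_div_iff₀ hhc]; linarith
      have h3 : (t : ℝ) ≤ ⌈E + c / hc⌉ := le_trans (by linarith) (Int.le_ceil _)
      exact_mod_cast h3

theorem sigz_nonneg {N M : ℕ} {Z : Type*} [Fintype Z]
    (P : Fin M → Z → Matrix (Fin N) (Fin N) ℝ) (hPnn : ∀ k z i j, 0 ≤ P k z i j)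
    (x : Fin N → ℝ) (hx : memX N x) (k : Fin M) (z : Z) : 0 ≤ sigz P k z x :=
  Finset.sum_nonneg fun i _ => mul_nonneg (hx.1 i) (Finset.sum_nonneg fun j _ => hPnn k z i j)

theorem sigz_total {N M : ℕ} {Z : Type*} [Fintype Z]
    (P : Fin M → Z → Matrix (Fin N) (Fin N) ℝ)
    (hPst : ∀ i : Fin N, ∑ k : Fin M, ∑ z : Z, ∑ j : Fin N, P k z i j = 1)
    (x : Fin N → ℝ) (hx : memX N x) : ∑ k : Fin M, ∑ z : Z, sigz P k z x = 1 := by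
  unfold sigz
  calc _ = ∑ k : Fin M, ∑ i, ∑ z : Z, x i * ∑ j, P k z i j :=
        Finset.sum_congr rfl fun k _ => Finset.sum_comm
    _ = ∑ i, ∑ k : Fin M, ∑ z : Z, x i * ∑ j, P k z i j := Finset.sum_comm
    _ = ∑ i, x i := by
        refine Finset.sum_congr rfl fun i _ => ?_
        simp_rw [← Finset.mul_sum]
        rw [hPst, mul_one]
    _ = 1 := hx.2

theorem lam_mem {N M : ℕ} {Z : Type*} [Fintype Z]
    (P : Fin M → Z → Matrix (Fin N) (Fin N) ℝ) (hPnn : ∀ k z i j, 0 ≤ P k z i j)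
    (x : Fin N → ℝ) (hx : memX N x) (k : Fin M) (z : Z) (h : sigz P k z x ≠ 0) :
    memX N (lam P k z x) := by
  constructor
  · intro j
    exact div_nonneg (Finset.sum_nonneg fun i _ => mul_nonneg (hx.1 i) (hPnn k z i j))
      (sigz_nonneg P hPnn x hx k z)
  · unfold lam
    rw [← Finset.sum_div, div_eq_one_iff_eq h, Finset.sum_comm]
    unfold sigz
    simp_rw [Finset.mul_sum]

/-- Inductive invariant for the value function. -/
def Inv (K : ℝ) (a : ℤ) (v : ℤ → ℝ) : Prop :=
  (∀ y, 0 ≤ v y) ∧ (∀ s y, s ≤ y → v s ≤ K + v y) ∧ KCv K v ∧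
      (∀ s y, s ≤ y → y ≤ a → v y ≤ v s)

/-- Averages of shifted invariant functions satisfy the invariant. -/
theorem inv_avg {M : ℕ} {Z : Type*} [Fintype Z] (K : ℝ) (a : ℤ) (d : Fin M → ℤ)
    (q : Fin M → Z → ℝ) (hq : ∀ k z, 0 ≤ q k z) (hq1 : ∑ k, ∑ z, q k z = 1)
    (b : Fin M → Z → ℤ) (hb : ∀ k z, q k z ≠ 0 → a - d k ≤ b k z)
    (v : Fin M → Z → ℤ → ℝ) (hv : ∀ k z, q k z ≠ 0 → Inv K (b k z) (v k z)) :
    Inv K a (fun y => ∑ k, ∑ z, if q k z = 0 then 0 else q k z * v k z (y - d k)) := by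
  have hs : ∀ y : ℤ, (∑ k, ∑ z, if q k z = 0 then 0 else q k z * v k z (y - d k)) =
      ∑ k, ∑ z, q k z * v k z (y - d k) := by
    intro y
    refine Finset.sum_congr rfl fun k _ => Finset.sum_congr rfl fun z _ => ?_
    split_ifs with h
    · rw [h, zero_mul]
    · rfl
  simp_rw [hs]
  have mono : ∀ f g : Fin M → Z → ℝ, (∀ k z, q k z ≠ 0 → f k z ≤ g k z) →
      ∑ k, ∑ z, q k z * f k z ≤ ∑ k, ∑ z, q k z * g k z := by
    intro f g h
    refine Finset.sum_le_sum fun k _ => Finset.sum_le_sum fun z _ => ?_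
    by_cases h0 : q k z = 0
    · rw [h0, zero_mul, zero_mul]
    · exact mul_le_mul_of_nonneg_left (h k z h0) (hq k z)
  have addc : ∀ (f : Fin M → Z → ℝ), ∑ k, ∑ z, q k z * (K + f k z) = K + ∑ k, ∑ z, q k z * f k z := by
    intro f
    simp_rw [mul_add, Finset.sum_add_distrib, ← Finset.sum_mul]
    rw [hq1, one_mul]
  refine ⟨?_, ?_, ?_, ?_⟩
  · intro y
    have := mono (fun _ _ => 0) (fun k z => v k z (y - d k)) (fun k z h => (hv k z h).1 _)
    simpa using this
  · intro s y h
    rw [← addc]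
    exact mono _ _ fun k z h0 => (hv k z h0).2.1 _ _ (by omega)
  · intro u m y h1 h2
    show (∑ k, ∑ z, q k z * v k z (m - d k)) * _ ≤
      _ * (K + ∑ k, ∑ z, q k z * v k z (y - d k)) + _ * (∑ k, ∑ z, q k z * v k z (u - d k))
    rw [← addc]
    have := mono (fun k z => v k z (m - d k) * ((y : ℝ) - u))
      (fun k z => ((m : ℝ) - u) * (K + v k z (y - d k)) + ((y : ℝ) - m) * v k z (u - d k)) (by
        intro k z h0
        have := (hv k z h0).2.2.1 (u - d k) (m - d k) (y - d k) (by omega) (by omega)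
        push_cast at this
        simpa using this)
    simp_rw [Finset.sum_mul, Finset.mul_sum, ← Finset.sum_add_distrib]
    refine le_trans (le_of_eq ?_) (this.trans (le_of_eq ?_))
    · refine Finset.sum_congr rfl fun k _ => Finset.sum_congr rfl fun z _ => ?_
      ring
    · refine Finset.sum_congr rfl fun k _ => Finset.sum_congr rfl fun z _ => ?_
      ring
  · intro s y h h2
    refine mono _ _ fun k z h0 => (hv k z h0).2.2.2 _ _ (by omega) ?_
    have := hb k z h0
    omega

/-- Proposition 7 with the Veinott-style bounds: under Assumption A1,
`s̲(x) ≤ s_n(x) ≤ s̄(x) ≤ S̲(x) ≤ S_n(x) ≤ S̄(x)`, and the `(s_n(x), S_n(x))` policy is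
optimal for the `(n+1)`-period problem. -/
theorem stmt19 {N M : ℕ} {Z : Type*} [Fintype Z] [Nonempty Z]
    (hN : 1 ≤ N) (hM : 1 ≤ M)
    (d : Fin M → ℤ) (hd : StrictMono d)
    (P : Fin M → Z → Matrix (Fin N) (Fin N) ℝ)
    (hPnn : ∀ k z i j, 0 ≤ P k z i j)
    (hPst : ∀ i : Fin N, ∑ k : Fin M, ∑ z : Z, ∑ j : Fin N, P k z i j = 1)
    (p hc : ℝ) (hp : 0 < p) (hhc : 0 < hc)
    (K : ℝ) (hK : 0 < K) (β : ℝ) (hβ0 : 0 ≤ β) (hβ1 : β < 1)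
    (hA1 : ∀ x : Fin N → ℝ, memX N x → ∀ (k : Fin M) (z : Z), sigz P k z x ≠ 0 →
      sStar P d p hc x - d k ≤ sStar P d p hc (lam P k z x)) :
    ∀ (n : ℕ) (x : Fin N → ℝ), memX N x →
      -- the chain of bounds
      (sLow P d p hc K x ≤ sn P d p hc β K n x ∧
        sn P d p hc β K n x ≤ sHigh P d p hc β K x ∧
        sHigh P d p hc β K x ≤ SLow P d p hc x ∧
        SLow P d p hc x ≤ Sn P d p hc β K n x ∧
        Sn P d p hc β K n x ≤ SHigh P d p hc β K x) ∧
      -- optimality of the (s_n(x), S_n(x)) policy for the (n+1)-period problem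
      (∀ s : ℤ, s < sn P d p hc β K n x →
        vIterK P d p hc β K (n + 1) x s =
          K + GKfun P d p hc β K n x (Sn P d p hc β K n x)) ∧
      (∀ s : ℤ, sn P d p hc β K n x ≤ s →
        vIterK P d p hc β K (n + 1) x s = GKfun P d p hc β K n x s) := by
  have step : ∀ (n : ℕ), (∀ x, memX N x → Inv K (sStar P d p hc x) (vIterK P d p hc β K n x)) →
      ∀ x, memX N x → _ := fun n ih x hx => by
    have hsig : ∀ k, 0 ≤ sig P k x := fun k =>
      Finset.sum_nonneg fun z _ => sigz_nonneg P hPnn x hx k z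
    obtain ⟨n1, n2, n3, n4, n5⟩ := newsvendor hM d p hc hp hhc (fun k => sig P k x) hsig
      (sigz_total P hPst x hx) (Lf P d p hc x) (fun y => rfl) (sStar P d p hc x) rfl
    obtain ⟨w1, w2, w3, w4⟩ := inv_avg K (sStar P d p hc x) d (fun k z => sigz P k z x)
      (sigz_nonneg P hPnn x hx) (sigz_total P hPst x hx)
      (fun k z => sStar P d p hc (lam P k z x)) (hA1 x hx)
      (fun k z => vIterK P d p hc β K n (lam P k z x))
      (fun k z h => ih _ (lam_mem P hPnn x hx k z h))
    exact core (fun y : ℤ => Lf P d p hc x (y : ℝ)) _ (sStar P d p hc x) K β hK hβ0 hβ1 n1 n2 n3 n4 n5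
      w1 w2 w3 w4 (GKfun P d p hc β K n x) (vIterK P d p hc β K (n + 1) x)
      (fun y => rfl) (fun s => by rw [vIterK]; rfl) (Sn P d p hc β K n x) (sn P d p hc β K n x) rfl rfl
  have hinv : ∀ n, ∀ x, memX N x → Inv K (sStar P d p hc x) (vIterK P d p hc β K n x) := by
    intro n
    induction n with
    | zero =>
      intro x _
      refine ⟨fun y => ?_, fun s y _ => ?_, fun u b y h1 _ => ?_, fun s y _ _ => ?_⟩ <;>
        simp only [vIterK]
      · exact le_rfl
      · linarith
      · have h1' : (u : ℝ) < b := by exact_mod_cast h1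
        nlinarith [mul_pos (sub_pos.2 h1') hK]
      · exact le_rfl
    | succ n ih => exact fun x hx => (step n ih x hx).2
  exact fun n x hx => (step n (hinv n) x hx).1

end InvCtrl
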